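/- Let T = (T₁,T₂) be a commuting 2-variable weighted shift on ℓ²(ℤ₊²) and let m,n ≥ 1. For 0 ≤ p ≤ m−1, 0 ≤ q ≤ n−1, let H_{(p,q)}^{(m,n)} be the closed span of {e_{(mℓ+p, nk+q)} : ℓ,k ≥ 0}. Then ℓ²(ℤ₊²) is the orthogonal direct sum of the subspaces H_{(p,q)}^{(m,n)}, each H_{(p,q)}^{(m,n)} is invariant under T₁ᵐ, T₂ⁿ, (T₁ᵐ)* and (T₂ⁿ)* (i.e., reduces T₁ᵐ and T₂ⁿ), and the pair (T₁ᵐ, T₂ⁿ) is a subnormal pair if and only if for every (p,q) the restricted pair (T₁ᵐ|_{H_{(p,q)}^{(m,n)}}, T₂ⁿ|_{H_{(p,q)}^{(m,n)}}) is a subnormal pair. -/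

import Mathlib

open MeasureTheory
open scoped ENNReal

noncomputable section

/-- The Hilbert space `ℓ²(ℤ₊²)`. -/
abbrev H2 : Type := lp (fun _ : ℕ × ℕ => ℂ) 2

/-- The canonical orthonormal basis vectors of `ℓ²(ℤ₊²)`. -/
noncomputable def e2 (k : ℕ × ℕ) : H2 := lp.single 2 k 1

/-- A bounded operator is subnormal if it has a normal extension. -/
def IsSubnormalOp {H : Type} [NormedAddCommGroup H] [InnerProductSpace ℂ H]
    (S : H →L[ℂ] H) : Prop :=
  ∃ (K : Type) (_ : NormedAddCommGroup K) (_ : InnerProductSpace ℂ K)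
    (_ : CompleteSpace K) (V : H →ₗᵢ[ℂ] K) (N : K →L[ℂ] K),
      IsStarNormal N ∧ ∀ x : H, N (V x) = V (S x)

/-- A pair of operators is a subnormal pair if it has a commuting normal extension. -/
def IsSubnormalPair {H : Type} [NormedAddCommGroup H] [InnerProductSpace ℂ H]
    (T₁ T₂ : H →L[ℂ] H) : Prop :=
  ∃ (K : Type) (_ : NormedAddCommGroup K) (_ : InnerProductSpace ℂ K)
    (_ : CompleteSpace K) (V : H →ₗᵢ[ℂ] K) (N₁ N₂ : K →L[ℂ] K),
      IsStarNormal N₁ ∧ IsStarNormal N₂ ∧ N₁ * N₂ = N₂ * N₁ ∧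
      (∀ x : H, N₁ (V x) = V (T₁ x)) ∧ (∀ x : H, N₂ (V x) = V (T₂ x))

/-- The subspace `H_{(p,q)}^{(m,n)}`: the closed span of `{e_{(mℓ+p, nk+q)} : ℓ,k ≥ 0}`. -/
noncomputable def Hsub (m n p q : ℕ) : Submodule ℂ H2 :=
  (Submodule.span ℂ
    (Set.range fun lk : ℕ × ℕ => e2 (m * lk.1 + p, n * lk.2 + q))).topologicalClosure

/-- The componentwise action of a finite family of operators on the `ℓ²` direct sum. -/
def piLpDiag {ι : Type} [Fintype ι] {K : ι → Type} [∀ i, NormedAddCommGroup (K i)]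
    [∀ i, InnerProductSpace ℂ (K i)] (N : ∀ i, K i →L[ℂ] K i) : PiLp 2 K →L[ℂ] PiLp 2 K :=
  (PiLp.continuousLinearEquiv 2 ℂ K).symm.toContinuousLinearMap ∘L
    (ContinuousLinearMap.pi fun i => N i ∘L ContinuousLinearMap.proj i) ∘L
    (PiLp.continuousLinearEquiv 2 ℂ K).toContinuousLinearMap

section DirectSum

variable {ι : Type} [Fintype ι] {K : ι → Type} [∀ i, NormedAddCommGroup (K i)]
  [∀ i, InnerProductSpace ℂ (K i)]

@[simp]
lemma piLpDiag_apply (N : ∀ i, K i →L[ℂ] K i) (x : PiLp 2 K) (i : ι) :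
    piLpDiag N x i = N i (x i) := rfl

lemma piLpDiag_mul (M N : ∀ i, K i →L[ℂ] K i) :
    piLpDiag M * piLpDiag N = piLpDiag fun i => M i * N i := rfl

lemma adjoint_piLpDiag [∀ i, CompleteSpace (K i)] (N : ∀ i, K i →L[ℂ] K i) :
    ContinuousLinearMap.adjoint (piLpDiag N) =
      piLpDiag fun i => ContinuousLinearMap.adjoint (N i) := by
  symm
  rw [ContinuousLinearMap.eq_adjoint_iff]
  intro x y
  simp [PiLp.inner_apply, ContinuousLinearMap.adjoint_inner_left]

lemma isStarNormal_piLpDiag [∀ i, CompleteSpace (K i)] {N : ∀ i, K i →L[ℂ] K i}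
    (hN : ∀ i, IsStarNormal (N i)) : IsStarNormal (piLpDiag N) := by
  refine ⟨?_⟩
  rw [ContinuousLinearMap.star_eq_adjoint, adjoint_piLpDiag]
  show _ * _ = _ * _
  rw [piLpDiag_mul, piLpDiag_mul]
  congr 1
  funext i
  exact (hN i).star_comm_self

/-- The componentwise action of a finite family of isometries between `ℓ²` direct sums. -/
def piLpIsometry {E : ι → Type} [∀ i, NormedAddCommGroup (E i)]
    [∀ i, InnerProductSpace ℂ (E i)] (V : ∀ i, E i →ₗᵢ[ℂ] K i) : PiLp 2 E →ₗᵢ[ℂ] PiLp 2 K where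
  toFun x := WithLp.toLp 2 fun i => V i (x i)
  map_add' x y := by ext i; simp
  map_smul' c x := by ext i; simp
  norm_map' x := by simp [PiLp.norm_eq_of_L2]

/-- A finite `ℓ²` direct sum of subnormal pairs is subnormal. -/
lemma IsSubnormalPair.piLpDiag {S₁ S₂ : ∀ i, K i →L[ℂ] K i}
    (h : ∀ i, IsSubnormalPair (S₁ i) (S₂ i)) :
    IsSubnormalPair (piLpDiag S₁) (piLpDiag S₂) := by
  choose L iL₁ iL₂ iL₃ V N₁ N₂ hN₁ hN₂ hN h₁ h₂ using h
  refine ⟨PiLp 2 L, inferInstance, inferInstance, inferInstance, piLpIsometry V,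
    _root_.piLpDiag N₁, _root_.piLpDiag N₂, isStarNormal_piLpDiag hN₁,
    isStarNormal_piLpDiag hN₂, ?_, fun x => ?_, fun x => ?_⟩
  · rw [piLpDiag_mul, piLpDiag_mul]
    exact congrArg _root_.piLpDiag (funext hN)
  · ext i
    exact h₁ i (x i)
  · ext i
    exact h₂ i (x i)

end DirectSum

section Intertwining

variable {H E : Type} [NormedAddCommGroup H] [InnerProductSpace ℂ H]
  [NormedAddCommGroup E] [InnerProductSpace ℂ E]

/-- Subnormality passes to a pair that is isometrically intertwined with a subnormal pair. -/
lemma IsSubnormalPair.of_isometry {T₁ T₂ : H →L[ℂ] H} {S₁ S₂ : E →L[ℂ] E}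
    (h : IsSubnormalPair T₁ T₂) (W : E →ₗᵢ[ℂ] H) (h₁ : ∀ x, W (S₁ x) = T₁ (W x))
    (h₂ : ∀ x, W (S₂ x) = T₂ (W x)) : IsSubnormalPair S₁ S₂ := by
  obtain ⟨K, iK₁, iK₂, iK₃, V, N₁, N₂, hN₁, hN₂, hN, hV₁, hV₂⟩ := h
  refine ⟨K, iK₁, iK₂, iK₃, V.comp W, N₁, N₂, hN₁, hN₂, hN, fun x => ?_, fun x => ?_⟩
  · simp [hV₁, h₁]
  · simp [hV₂, h₂]

/-- A pair reduced by a finite orthogonal decomposition is subnormal if all its restrictions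
are. -/
lemma IsSubnormalPair.of_isInternal {ι : Type} [Fintype ι] [DecidableEq ι]
    {U : ι → Submodule ℂ H} (hU : DirectSum.IsInternal U)
    (hU' : OrthogonalFamily ℂ (fun i => U i) fun i => (U i).subtypeₗᵢ)
    {T₁ T₂ : H →L[ℂ] H} {S₁ S₂ : ∀ i, U i →L[ℂ] U i}
    (h₁ : ∀ i x, (S₁ i x : H) = T₁ x) (h₂ : ∀ i x, (S₂ i x : H) = T₂ x)
    (h : ∀ i, IsSubnormalPair (S₁ i) (S₂ i)) : IsSubnormalPair T₁ T₂ := by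
  let W := hU.isometryL2OfOrthogonalFamily hU'
  have key : ∀ (T : H →L[ℂ] H) (S : ∀ i, U i →L[ℂ] U i), (∀ i x, (S i x : H) = T x) →
      ∀ x, W (T x) = _root_.piLpDiag S (W x) := by
    intro T S hS x
    rw [← W.symm.injective.eq_iff, W.symm_apply_apply]
    conv_lhs => rw [← W.symm_apply_apply x]
    simp only [W, hU.isometryL2OfOrthogonalFamily_symm_apply hU', map_sum, piLpDiag_apply, hS]
  exact (IsSubnormalPair.piLpDiag h).of_isometry W.toLinearIsometry
    (key T₁ S₁ h₁) (key T₂ S₂ h₂)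

end Intertwining

lemma inner_e2_left (k : ℕ × ℕ) (x : H2) : inner ℂ (e2 k) x = x k := by
  simp [e2, lp.inner_single_left]

lemma e2_apply_ne {j k : ℕ × ℕ} (h : k ≠ j) : (e2 j : H2) k = 0 :=
  lp.single_apply_ne _ _ _ h

lemma e2_mem_Hsub {m n p q : ℕ} {k : ℕ × ℕ} (h₁ : k.1 % m = p) (h₂ : k.2 % n = q) :
    e2 k ∈ Hsub m n p q := by
  refine Submodule.le_topologicalClosure _ (Submodule.subset_span ⟨(k.1 / m, k.2 / n), ?_⟩)
  subst h₁ h₂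
  simp only [Nat.div_add_mod]

/-- The subspace `Hsub m n p q` consists of the sequences supported on a residue class. -/
lemma mem_Hsub_iff {m n p q : ℕ} (hp : p < m) (hq : q < n) {x : H2} :
    x ∈ Hsub m n p q ↔ ∀ k : ℕ × ℕ, ¬(k.1 % m = p ∧ k.2 % n = q) → x k = 0 := by
  constructor
  · intro hx k hk
    have hle : Hsub m n p q ≤ (ℂ ∙ e2 k)ᗮ := by
      refine Submodule.topologicalClosure_minimal _ (Submodule.span_le.2 ?_)
        (Submodule.isClosed_orthogonal _)
      rintro _ ⟨lk, rfl⟩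
      rw [SetLike.mem_coe, Submodule.mem_orthogonal_singleton_iff_inner_right, inner_e2_left]
      refine e2_apply_ne ?_
      rintro rfl
      exact hk ⟨by simp [Nat.mod_eq_of_lt hp],
        by simp [Nat.mod_eq_of_lt hq]⟩
    have := hle hx
    rwa [Submodule.mem_orthogonal_singleton_iff_inner_right, inner_e2_left] at this
  · intro hx
    have hsum := lp.hasSum_single (p := 2) (by simp) x
    refine (Submodule.isClosed_topologicalClosure _).mem_of_tendsto hsum
      (Filter.Eventually.of_forall fun s => Submodule.sum_mem _ fun k _ => ?_)
    have hk : lp.single 2 k (x k) = x k • e2 k := by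
      rw [e2, ← lp.single_smul, smul_eq_mul, mul_one]
    rw [hk]
    by_cases h : k.1 % m = p ∧ k.2 % n = q
    · exact Submodule.smul_mem _ _ (e2_mem_Hsub h.1 h.2)
    · rw [hx k h, zero_smul]
      exact zero_mem _

lemma inner_eq_zero_of_mem_Hsub {m n p q p' q' : ℕ} (hp : p < m) (hq : q < n) (hp' : p' < m)
    (hq' : q' < n) (hne : (p, q) ≠ (p', q')) {x y : H2} (hx : x ∈ Hsub m n p q)
    (hy : y ∈ Hsub m n p' q') : inner ℂ x y = 0 := by
  rw [lp.inner_eq_tsum, ← tsum_zero (α := ℂ) (β := ℕ × ℕ)]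
  congr 1
  funext k
  by_cases h : k.1 % m = p ∧ k.2 % n = q
  · rw [(mem_Hsub_iff hp' hq').1 hy k fun h' =>
      hne (Prod.ext (h.1.symm.trans h'.1) (h.2.symm.trans h'.2)), inner_zero_right]
  · rw [(mem_Hsub_iff hp hq).1 hx k h, inner_zero_left]

lemma iSup_Hsub_eq_top {m n : ℕ} (hm : 0 < m) (hn : 0 < n) :
    (⨆ p : Fin m, ⨆ q : Fin n, Hsub m n p q) = ⊤ := by
  rw [eq_top_iff]
  intro x _
  let y (p : Fin m) (q : Fin n) : H2 :=
    ⟨fun k => if k.1 % m = p ∧ k.2 % n = q then x k else 0,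
      (lp.memℓp x).mono' fun k => by split_ifs <;> simp⟩
  have hy (p : Fin m) (q : Fin n) : y p q ∈ Hsub m n p q :=
    (mem_Hsub_iff p.2 q.2).2 fun k hk => if_neg hk
  have hx : x = ∑ p, ∑ q, y p q := by
    ext k
    simp only [lp.coeFn_sum, Finset.sum_apply]
    rw [Finset.sum_eq_single ⟨k.1 % m, Nat.mod_lt _ hm⟩,
      Finset.sum_eq_single ⟨k.2 % n, Nat.mod_lt _ hn⟩]
    · exact (if_pos ⟨rfl, rfl⟩).symm
    · exact fun q _ hq => if_neg fun h => hq (Fin.ext h.2.symm)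
    · simp
    · exact fun p _ hp => Finset.sum_eq_zero fun q _ => if_neg fun h => hp (Fin.ext h.1.symm)
    · simp
  rw [hx]
  exact Submodule.sum_mem _ fun p _ => Submodule.sum_mem _ fun q _ =>
    Submodule.mem_iSup_of_mem p (Submodule.mem_iSup_of_mem q (hy p q))

/-- An operator mapping every basis vector into the subspace of its own residue class leaves
every `Hsub m n p q` invariant. -/
lemma apply_mem_Hsub {m n : ℕ} {A : H2 →L[ℂ] H2}
    (hA : ∀ k : ℕ × ℕ, A (e2 k) ∈ Hsub m n (k.1 % m) (k.2 % n)) {p q : ℕ} (hp : p < m)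
    (hq : q < n) {x : H2} (hx : x ∈ Hsub m n p q) : A x ∈ Hsub m n p q := by
  have hle : Hsub m n p q ≤ (Hsub m n p q).comap (A : H2 →ₗ[ℂ] H2) := by
    refine Submodule.topologicalClosure_minimal _ (Submodule.span_le.2 ?_)
      ((Submodule.isClosed_topologicalClosure _).preimage A.continuous)
    rintro _ ⟨lk, rfl⟩
    have := hA (m * lk.1 + p, n * lk.2 + q)
    simpa [Nat.mul_add_mod, Nat.mod_eq_of_lt hp, Nat.mod_eq_of_lt hq] using this
  exact hle hx

/-- The adjoint of an operator as in `apply_mem_Hsub` leaves every `Hsub m n p q` invariant. -/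
lemma adjoint_apply_mem_Hsub {m n : ℕ} {A : H2 →L[ℂ] H2}
    (hA : ∀ k : ℕ × ℕ, A (e2 k) ∈ Hsub m n (k.1 % m) (k.2 % n)) {p q : ℕ} (hp : p < m)
    (hq : q < n) {x : H2} (hx : x ∈ Hsub m n p q) :
    ContinuousLinearMap.adjoint A x ∈ Hsub m n p q := by
  refine (mem_Hsub_iff hp hq).2 fun k hk => ?_
  rw [← inner_e2_left, ContinuousLinearMap.adjoint_inner_right]
  exact inner_eq_zero_of_mem_Hsub (Nat.mod_lt _ (pos_of_gt hp)) (Nat.mod_lt _ (pos_of_gt hq))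
    hp hq (fun h => hk (Prod.ext_iff.1 h)) (hA k) hx

/-- Powers of a weighted translation of the basis are weighted translations. -/
lemma exists_pow_apply_e2 {T : H2 →L[ℂ] H2} {w : ℕ × ℕ → ℝ} {v : ℕ × ℕ}
    (hT : ∀ k : ℕ × ℕ, T (e2 k) = (w k : ℂ) • e2 (k + v)) (j : ℕ) (k : ℕ × ℕ) :
    ∃ c : ℂ, (T ^ j) (e2 k) = c • e2 (k + j • v) := by
  induction j with
  | zero => exact ⟨1, by simp⟩
  | succ j ih =>
    obtain ⟨c, hc⟩ := ih
    refine ⟨c * w (k + j • v), ?_⟩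
    rw [pow_succ', mul_apply_eq_comp, hc, map_smul, hT, smul_smul, succ_nsmul,
      add_assoc]

/-- For a commuting 2-variable weighted shift `T = (T₁,T₂)` and `m,n ≥ 1`, the space
`ℓ²(ℤ₊²)` is the orthogonal direct sum of the subspaces `H_{(p,q)}^{(m,n)}`, each of which
reduces `T₁ᵐ` and `T₂ⁿ`; and `(T₁ᵐ,T₂ⁿ)` is a subnormal pair iff every restricted pair
`(T₁ᵐ|_{H_{(p,q)}}, T₂ⁿ|_{H_{(p,q)}})` is a subnormal pair. -/
theorem power_subnormal_iff_all_summands_subnormal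
    (α β : ℕ × ℕ → ℝ)
    (hαpos : ∀ k, 0 < α k) (hβpos : ∀ k, 0 < β k)
    (hαbdd : ∃ C : ℝ, ∀ k, α k ≤ C) (hβbdd : ∃ C : ℝ, ∀ k, β k ≤ C)
    (T₁ T₂ : H2 →L[ℂ] H2)
    (hT₁ : ∀ k : ℕ × ℕ, T₁ (e2 k) = (α k : ℂ) • e2 (k.1 + 1, k.2))
    (hT₂ : ∀ k : ℕ × ℕ, T₂ (e2 k) = (β k : ℂ) • e2 (k.1, k.2 + 1))
    (hcomm : ∀ k : ℕ × ℕ, β (k.1 + 1, k.2) * α k = α (k.1, k.2 + 1) * β k)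
    (m n : ℕ) (hm : 1 ≤ m) (hn : 1 ≤ n) :
    ((⨆ p : Fin m, ⨆ q : Fin n, Hsub m n p q) = ⊤) ∧
    (∀ p q p' q' : ℕ, p < m → q < n → p' < m → q' < n → (p, q) ≠ (p', q') →
      ∀ x ∈ Hsub m n p q, ∀ y ∈ Hsub m n p' q', @inner ℂ H2 _ x y = 0) ∧
    (∀ p q : ℕ, p < m → q < n →
      (∀ x ∈ Hsub m n p q, (T₁ ^ m) x ∈ Hsub m n p q) ∧
      (∀ x ∈ Hsub m n p q, (T₂ ^ n) x ∈ Hsub m n p q) ∧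
      (∀ x ∈ Hsub m n p q, ContinuousLinearMap.adjoint (T₁ ^ m) x ∈ Hsub m n p q) ∧
      (∀ x ∈ Hsub m n p q, ContinuousLinearMap.adjoint (T₂ ^ n) x ∈ Hsub m n p q)) ∧
    (IsSubnormalPair (T₁ ^ m) (T₂ ^ n) ↔
      ∀ p q : ℕ, p < m → q < n →
        ∀ S₁ S₂ : Hsub m n p q →L[ℂ] Hsub m n p q,
          (∀ x : Hsub m n p q, (S₁ x : H2) = (T₁ ^ m) x) →
          (∀ x : Hsub m n p q, (S₂ x : H2) = (T₂ ^ n) x) →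
          IsSubnormalPair S₁ S₂) := by
  have h₁ (k : ℕ × ℕ) : (T₁ ^ m) (e2 k) ∈ Hsub m n (k.1 % m) (k.2 % n) := by
    obtain ⟨c, hc⟩ := exists_pow_apply_e2 (v := (1, 0)) hT₁ m k
    rw [hc]
    exact Submodule.smul_mem _ _ (e2_mem_Hsub (by simp) (by simp))
  have h₂ (k : ℕ × ℕ) : (T₂ ^ n) (e2 k) ∈ Hsub m n (k.1 % m) (k.2 % n) := by
    obtain ⟨c, hc⟩ := exists_pow_apply_e2 (v := (0, 1)) hT₂ n k
    rw [hc]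
    exact Submodule.smul_mem _ _ (e2_mem_Hsub (by simp) (by simp))
  refine ⟨iSup_Hsub_eq_top hm hn,
    fun p q p' q' hp hq hp' hq' hne x hx y hy =>
      inner_eq_zero_of_mem_Hsub hp hq hp' hq' hne hx hy,
    fun p q hp hq => ⟨fun x hx => apply_mem_Hsub h₁ hp hq hx,
      fun x hx => apply_mem_Hsub h₂ hp hq hx, fun x hx => adjoint_apply_mem_Hsub h₁ hp hq hx,
      fun x hx => adjoint_apply_mem_Hsub h₂ hp hq hx⟩,
    fun h p q _ _ S₁ S₂ hS₁ hS₂ => h.of_isometry (Hsub m n p q).subtypeₗᵢ hS₁ hS₂,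
    fun h => ?_⟩
  let U (i : Fin m × Fin n) : Submodule ℂ H2 := Hsub m n i.1 i.2
  have hU' : OrthogonalFamily ℂ (fun i => U i) fun i => (U i).subtypeₗᵢ := fun i j hij x y =>
    inner_eq_zero_of_mem_Hsub i.1.2 i.2.2 j.1.2 j.2.2
      (fun h => hij (Prod.ext (Fin.ext (Prod.ext_iff.1 h).1) (Fin.ext (Prod.ext_iff.1 h).2)))
      x.2 y.2
  have hU : DirectSum.IsInternal U :=
    (DirectSum.isInternal_submodule_iff_iSupIndep_and_iSup_eq_top U).2
      ⟨hU'.independent, iSup_prod.trans (iSup_Hsub_eq_top hm hn)⟩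
  let S₁ (i : Fin m × Fin n) : U i →L[ℂ] U i :=
    (T₁ ^ m).restrict fun x hx => apply_mem_Hsub h₁ i.1.2 i.2.2 hx
  let S₂ (i : Fin m × Fin n) : U i →L[ℂ] U i :=
    (T₂ ^ n).restrict fun x hx => apply_mem_Hsub h₂ i.1.2 i.2.2 hx
  exact IsSubnormalPair.of_isInternal hU hU' (S₁ := S₁) (S₂ := S₂) (fun _ _ => rfl)
    (fun _ _ => rfl) fun i => h i.1 i.2 i.1.2 i.2.2 (S₁ i) (S₂ i) (fun _ => rfl) fun _ => rfl

end
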